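/- Let (A, Δ_A) be an anti-flexible coalgebra and V a vector space with linear maps φ: A→V⊗A (φ(a) = a(-1)⊗a(0)), ψ: A→A⊗V (ψ(a) = a(0)⊗a(1)), ρ: V→A⊗V (ρ(x) = x[-1]⊗x[0]), γ: V→V⊗A (γ(x) = x[0]⊗x[1]), P: A→V⊗V (P(a) = a<1>⊗a<2>) and Δ_V: V→V⊗V (Δ_V(x) = x1⊗x2). Define on E = A⊕V the comultiplication Δ_E(a) = Δ_A(a) + φ(a) + ψ(a) + P(a) and Δ_E(x) = Δ_V(x) + ρ(x) + γ(x). Then (E, Δ_E) is an anti-flexible coalgebra if and only if for all a in A and x in V: (C1) φ(a1)⊗a2 + γ(a(-1))⊗a(0) − a(-1)⊗Δ_A(a(0)) = τ13(Δ_A(a(0))⊗a(1) − a1⊗ψ(a2) − a(0)⊗ρ(a(1))); (C2) D := ψ(a1)⊗a2 + ρ(a(-1))⊗a(0) − a1⊗φ(a2) − a(0)⊗γ(a(1)) satisfies D = τ13(D); (C3) Δ_V(a(-1))⊗a(0) + P(a1)⊗a2 − a(-1)⊗φ(a(0)) − a<1>⊗γ(a<2>) = τ13(ψ(a(0))⊗a(1)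 + ρ(a<1>)⊗a<2> − a(0)⊗Δ_V(a(1)) − a1⊗P(a2)); (C4) D := a(-1)⊗ψ(a(0)) + a<1>⊗ρ(a<2>) − φ(a(0))⊗a(1) − γ(a<1>)⊗a<2> satisfies D = τ13(D); (C5) ρ(x1)⊗x2 + ψ(x[-1])⊗x[0] − x[-1]⊗Δ_V(x[0]) = τ13(Δ_V(x[0])⊗x[1] − x[0]⊗φ(x[1]) − x1⊗γ(x2)); (C6) D := γ(x1)⊗x2 + φ(x[-1])⊗x[0] − x[0]⊗ψ(x[1]) − x1⊗ρ(x2) satisfies D = τ13(D); (C7) Δ_A(x[-1])⊗x[0] − x[-1]⊗ρ(x[0]) = τ13(γ(x[0])⊗x[1] − x[0]⊗Δ_A(x[1])); (C8) D := ρ(x[0])⊗x[1] − x[-1]⊗γ(x[0]) satisfies D = τ13(D); (C9) D := Δ_V(a<1>)⊗a<2> − a<1>⊗Δ_V(a<2>) + P(a(0))⊗a(1) − a(-1)⊗P(a(0)) satisfies D = τ13(D); (C10) D := Δ_V(x1)⊗x2 − x1⊗Δ_V(x2) + P(x[-1])⊗x[0] − x[0]⊗P(x[1]) satisfies D = τ13(D).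 -/

import Mathlib

open TensorProduct LinearMap

namespace AntiFlexible

section Basic

variable (K : Type*) [Field K] [CharZero K]
variable (M N P : Type*)
variable [AddCommGroup M] [Module K M] [AddCommGroup N] [Module K N] [AddCommGroup P] [Module K P]

/-- The flip map `τ : M ⊗ N → N ⊗ M`. -/
noncomputable def τ : M ⊗[K] N →ₗ[K] N ⊗[K] M := (TensorProduct.comm K M N).toLinearMap

/-- `τ₁₃ : (M ⊗ N) ⊗ P → (P ⊗ N) ⊗ M`, exchanging the outer tensor factors. -/
noncomputable def τ₁₃ : (M ⊗[K] N) ⊗[K] P →ₗ[K] (P ⊗[K] N) ⊗[K] M :=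
  (TensorProduct.assoc K P N M).symm.toLinearMap ∘ₗ
    (lTensor P (τ K M N)) ∘ₗ (TensorProduct.comm K (M ⊗[K] N) P).toLinearMap

/-- The reassociator `M ⊗ (N ⊗ P) → (M ⊗ N) ⊗ P`. -/
noncomputable def α : M ⊗[K] (N ⊗[K] P) →ₗ[K] (M ⊗[K] N) ⊗[K] P :=
  (TensorProduct.assoc K M N P).symm.toLinearMap

/-- The antisymmetrizer `id - τ` on `M ⊗ M`. -/
noncomputable def ω : M ⊗[K] M →ₗ[K] M ⊗[K] M := LinearMap.id - τ K M M

end Basic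

section Structures

variable {K : Type*} [Field K] [CharZero K]
variable {A H V : Type*}
variable [AddCommGroup A] [Module K A] [AddCommGroup H] [Module K H]
variable [AddCommGroup V] [Module K V]

/-- Anti-flexible algebra: `(ab)c - a(bc) = (cb)a - c(ba)`. -/
def IsAFAlgebra (m : A →ₗ[K] A →ₗ[K] A) : Prop :=
  ∀ a b c, m (m a b) c - m a (m b c) = m (m c b) a - m c (m b a)

/-- The coassociativity defect `(Δ ⊗ id)Δ - (id ⊗ Δ)Δ`, viewed in `(A ⊗ A) ⊗ A`. -/
noncomputable def coassocDefect (Δ : A →ₗ[K] A ⊗[K] A) : A →ₗ[K] (A ⊗[K] A) ⊗[K] A :=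
  (rTensor A Δ) ∘ₗ Δ - (α K A A A) ∘ₗ (lTensor A Δ) ∘ₗ Δ

/-- Anti-flexible coalgebra: the coassociativity defect is `τ₁₃`-invariant. -/
def IsAFCoalgebra (Δ : A →ₗ[K] A ⊗[K] A) : Prop :=
  ∀ a, coassocDefect Δ a = τ₁₃ K A A A (coassocDefect Δ a)

/-- Anti-flexible bialgebra. -/
def IsAFBialgebra (m : A →ₗ[K] A →ₗ[K] A) (Δ : A →ₗ[K] A ⊗[K] A) : Prop :=
  IsAFAlgebra m ∧ IsAFCoalgebra Δ ∧
  (∀ a b, Δ (m a b) + τ K A A (Δ (m b a)) =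
      rTensor A (m b) (τ K A A (Δ a)) + lTensor A (m.flip a) (τ K A A (Δ b))
      + rTensor A (m.flip b) (Δ a) + lTensor A (m a) (Δ b)) ∧
  (∀ a b, ω K A (lTensor A (m.flip b) (Δ a) - rTensor A (m b) (Δ a)
      - lTensor A (m.flip a) (Δ b) + rTensor A (m a) (Δ b)) = 0)

/-- `V` is a bimodule over the anti-flexible algebra `(H, m)` via `tr = ▷` and `tl = ◁`. -/
def IsAFBimodule (m : H →ₗ[K] H →ₗ[K] H)
    (tr : H →ₗ[K] V →ₗ[K] V) (tl : V →ₗ[K] H →ₗ[K] V) : Prop :=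
  (∀ x y v, tr (m x y) v - tr x (tr y v) = tl (tl v y) x - tl v (m y x)) ∧
  (∀ x y v, tl (tr x v) y - tr x (tl v y) = tl (tr y v) x - tr y (tl v x))

/-- `V` is a bicomodule over the anti-flexible coalgebra `(H, Δ)` via `φ` and `ψ`. -/
def IsAFBicomodule (Δ : H →ₗ[K] H ⊗[K] H)
    (φ : V →ₗ[K] H ⊗[K] V) (ψ : V →ₗ[K] V ⊗[K] H) : Prop :=
  (∀ v, rTensor V Δ (φ v) - α K H H V (lTensor H φ (φ v))
      = τ₁₃ K V H H (rTensor H ψ (ψ v) - α K V H H (lTensor V Δ (ψ v)))) ∧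
  (∀ v, rTensor H φ (ψ v) - α K H V H (lTensor H ψ (φ v))
      = τ₁₃ K H V H (rTensor H φ (ψ v) - α K H V H (lTensor H ψ (φ v))))

/-- Anti-flexible Hopf bimodule over `(H, m, Δ)`, with conditions (HM1)-(HM3). -/
def IsAFHopfBimodule (m : H →ₗ[K] H →ₗ[K] H) (Δ : H →ₗ[K] H ⊗[K] H)
    (tr : H →ₗ[K] V →ₗ[K] V) (tl : V →ₗ[K] H →ₗ[K] V)
    (φ : V →ₗ[K] H ⊗[K] V) (ψ : V →ₗ[K] V ⊗[K] H) : Prop :=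
  IsAFBimodule m tr tl ∧ IsAFBicomodule Δ φ ψ ∧
  -- (HM1)
  (∀ x v, φ (tr x v) + τ K V H (ψ (tl v x))
      = lTensor H (tr x) (φ v) + lTensor H (tl.flip x) (τ K V H (ψ v))) ∧
  -- (HM2)
  (∀ x v, ψ (tr x v) + τ K H V (φ (tl v x))
      = rTensor H (tr.flip v) (Δ x) + lTensor V (m x) (ψ v)
      + lTensor V (m.flip x) (τ K H V (φ v)) + rTensor H (tl v) (τ K H H (Δ x))) ∧
  -- (HM3)
  (∀ x v, rTensor H (tr x) (ψ v) - rTensor H (tl v) (Δ x) - lTensor V (m.flip x) (ψ v)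
      = τ K H V (- lTensor H (tl.flip x) (φ v) + rTensor V (m x) (φ v)
        + lTensor H (tr.flip v) (Δ x)))

/-- `A` is a braided anti-flexible bialgebra over `(H, mH, ΔH)`:
an anti-flexible algebra and coalgebra in the category of anti-flexible Hopf bimodules,
satisfying (BB1) and (BB2). -/
def IsBraidedAFBialgebra (mA : A →ₗ[K] A →ₗ[K] A) (ΔA : A →ₗ[K] A ⊗[K] A)
    (mH : H →ₗ[K] H →ₗ[K] H) (ΔH : H →ₗ[K] H ⊗[K] H)
    (tr : H →ₗ[K] A →ₗ[K] A) (tl : A →ₗ[K] H →ₗ[K] A)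
    (φ : A →ₗ[K] H ⊗[K] A) (ψ : A →ₗ[K] A ⊗[K] H) : Prop :=
  IsAFAlgebra mA ∧ IsAFCoalgebra ΔA ∧
  IsAFHopfBimodule mH ΔH tr tl φ ψ ∧
  -- H-bimodule algebra
  (∀ x a b, mA (tr x a) b - tr x (mA a b) = tl (mA b a) x - mA b (tl a x)) ∧
  (∀ x a b, mA a (tr x b) - mA (tl a x) b = mA b (tr x a) - mA (tl b x) a) ∧
  -- H-bimodule coalgebra
  (∀ x b, ΔA (tr x b) + τ K A A (ΔA (tl b x))
      = lTensor A (tl.flip x) (τ K A A (ΔA b)) + lTensor A (tr x) (ΔA b)) ∧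
  (∀ x b, ω K A (rTensor A (tr x) (ΔA b) - lTensor A (tl.flip x) (ΔA b)) = 0) ∧
  -- H-bicomodule algebra
  (∀ a b, φ (mA a b) + τ K A H (ψ (mA b a))
      = lTensor H (mA a) (φ b) + lTensor H (mA.flip a) (τ K A H (ψ b))) ∧
  (∀ a b, lTensor H (mA.flip b) (φ a) - lTensor H (mA.flip a) (φ b)
      = τ K A H (rTensor H (mA a) (ψ b) - rTensor H (mA b) (ψ a))) ∧
  -- H-bicomodule coalgebra
  (∀ a, rTensor A φ (ΔA a) - α K H A A (lTensor H ΔA (φ a))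
      = τ₁₃ K A A H (rTensor H ΔA (ψ a) - α K A A H (lTensor A ψ (ΔA a)))) ∧
  (∀ a, rTensor A ψ (ΔA a) - α K A H A (lTensor A φ (ΔA a))
      = τ₁₃ K A H A (rTensor A ψ (ΔA a) - α K A H A (lTensor A φ (ΔA a)))) ∧
  -- (BB1)
  (∀ a b, ΔA (mA a b) + τ K A A (ΔA (mA b a))
      = rTensor A (mA.flip b) (ΔA a) + rTensor A (mA b) (τ K A A (ΔA a))
      + lTensor A (mA a) (ΔA b) + lTensor A (mA.flip a) (τ K A A (ΔA b))
      + rTensor A (tr.flip b) (φ a) + rTensor A (tl b) (τ K A H (ψ a))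
      + lTensor A (tl a) (ψ b) + lTensor A (tr.flip a) (τ K H A (φ b))) ∧
  -- (BB2)
  (∀ a b, ω K A (lTensor A (mA.flip b) (ΔA a) - rTensor A (mA b) (ΔA a)
        - lTensor A (mA.flip a) (ΔA b) + rTensor A (mA a) (ΔA b))
      + ω K A (lTensor A (tr.flip b) (ψ a) - rTensor A (tl b) (φ a)
        - lTensor A (tr.flip a) (ψ b) + rTensor A (tl a) (φ b)) = 0)

/-- The (cocycle) cross product multiplication on `A × H`:
`(a,x)(b,y) = (ab + x⇀b + a↼y + σ(x,y), xy + x◁b + a▷y + θ(a,b))`,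
where `tr = ⇀`, `tl = ↼`, `sr = ▷`, `sl = ◁`. -/
noncomputable def prodMul (mA : A →ₗ[K] A →ₗ[K] A) (mH : H →ₗ[K] H →ₗ[K] H)
    (tr : H →ₗ[K] A →ₗ[K] A) (tl : A →ₗ[K] H →ₗ[K] A)
    (sr : A →ₗ[K] H →ₗ[K] H) (sl : H →ₗ[K] A →ₗ[K] H)
    (σ : H →ₗ[K] H →ₗ[K] A) (θ : A →ₗ[K] A →ₗ[K] H) :
    (A × H) →ₗ[K] (A × H) →ₗ[K] (A × H) :=
  ((mA ∘ₗ fst K A H).compl₂ (fst K A H) + (tr ∘ₗ snd K A H).compl₂ (fst K A H)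
    + (tl ∘ₗ fst K A H).compl₂ (snd K A H)
    + (σ ∘ₗ snd K A H).compl₂ (snd K A H)).compr₂ (inl K A H)
  + ((mH ∘ₗ snd K A H).compl₂ (snd K A H) + (sl ∘ₗ snd K A H).compl₂ (fst K A H)
    + (sr ∘ₗ fst K A H).compl₂ (snd K A H)
    + (θ ∘ₗ fst K A H).compl₂ (fst K A H)).compr₂ (inr K A H)

/-- The (cycle) cross coproduct comultiplication on `A × H`:
`Δ(a) = Δ_A(a) + φ(a) + ψ(a) + P(a)` and `Δ(x) = Δ_H(x) + ρ(x) + γ(x) + Q(x)`. -/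
noncomputable def prodComul (ΔA : A →ₗ[K] A ⊗[K] A) (ΔH : H →ₗ[K] H ⊗[K] H)
    (φ : A →ₗ[K] H ⊗[K] A) (ψ : A →ₗ[K] A ⊗[K] H)
    (ρ : H →ₗ[K] A ⊗[K] H) (γ : H →ₗ[K] H ⊗[K] A)
    (P : A →ₗ[K] H ⊗[K] H) (Q : H →ₗ[K] A ⊗[K] A) :
    (A × H) →ₗ[K] (A × H) ⊗[K] (A × H) :=
  (TensorProduct.map (inl K A H) (inl K A H)) ∘ₗ ΔA ∘ₗ fst K A H
  + (TensorProduct.map (inr K A H) (inl K A H)) ∘ₗ φ ∘ₗ fst K A H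
  + (TensorProduct.map (inl K A H) (inr K A H)) ∘ₗ ψ ∘ₗ fst K A H
  + (TensorProduct.map (inr K A H) (inr K A H)) ∘ₗ P ∘ₗ fst K A H
  + (TensorProduct.map (inr K A H) (inr K A H)) ∘ₗ ΔH ∘ₗ snd K A H
  + (TensorProduct.map (inl K A H) (inr K A H)) ∘ₗ ρ ∘ₗ snd K A H
  + (TensorProduct.map (inr K A H) (inl K A H)) ∘ₗ γ ∘ₗ snd K A H
  + (TensorProduct.map (inl K A H) (inl K A H)) ∘ₗ Q ∘ₗ snd K A H

/-- The linear map `(a, x) ↦ (a + r(x), s(x))` on `A × V`. -/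
noncomputable def phiRS (r : V →ₗ[K] A) (s : V →ₗ[K] V) : (A × V) →ₗ[K] (A × V) :=
  (fst K A V + r ∘ₗ snd K A V).prod (s ∘ₗ snd K A V)

end Structures

end AntiFlexible

open AntiFlexible

set_option linter.unusedSectionVars false

namespace AntiFlexible

section Tensor

variable {K : Type*} [Field K] [CharZero K]
variable {M N P M' N' P' : Type*}
variable [AddCommGroup M] [Module K M] [AddCommGroup N] [Module K N] [AddCommGroup P] [Module K P]
variable [AddCommGroup M'] [Module K M'] [AddCommGroup N'] [Module K N']
variable [AddCommGroup P'] [Module K P']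

@[simp]
theorem τ₁₃_tmul (m : M) (n : N) (p : P) : τ₁₃ K M N P (m ⊗ₜ n ⊗ₜ p) = p ⊗ₜ n ⊗ₜ m := by
  simp [τ₁₃, τ]

@[simp]
theorem α_tmul (m : M) (n : N) (p : P) : α K M N P (m ⊗ₜ (n ⊗ₜ p)) = m ⊗ₜ n ⊗ₜ p := by
  simp [α]

theorem τ₁₃_τ₁₃ (t : (M ⊗[K] N) ⊗[K] P) : τ₁₃ K P N M (τ₁₃ K M N P t) = t := by
  have h : τ₁₃ K P N M ∘ₗ τ₁₃ K M N P = LinearMap.id := by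
    ext; simp
  exact LinearMap.congr_fun h t

theorem eq_τ₁₃_comm (t : (M ⊗[K] N) ⊗[K] P) (u : (P ⊗[K] N) ⊗[K] M) :
    t = τ₁₃ K P N M u ↔ u = τ₁₃ K M N P t := by
  constructor <;> rintro rfl <;> rw [τ₁₃_τ₁₃]

theorem map_τ₁₃ (f : M →ₗ[K] M') (g : N →ₗ[K] N') (h : P →ₗ[K] P') (t : (M ⊗[K] N) ⊗[K] P) :
    TensorProduct.map (TensorProduct.map h g) f (τ₁₃ K M N P t)
      = τ₁₃ K M' N' P' (TensorProduct.map (TensorProduct.map f g) h t) := by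
  have H : TensorProduct.map (TensorProduct.map h g) f ∘ₗ τ₁₃ K M N P
      = τ₁₃ K M' N' P' ∘ₗ TensorProduct.map (TensorProduct.map f g) h := by
    ext; simp
  exact LinearMap.congr_fun H t

theorem map_α (f : M →ₗ[K] M') (g : N →ₗ[K] N') (h : P →ₗ[K] P') (t : M ⊗[K] (N ⊗[K] P)) :
    TensorProduct.map (TensorProduct.map f g) h (α K M N P t)
      = α K M' N' P' (TensorProduct.map f (TensorProduct.map g h) t) := by
  have H : TensorProduct.map (TensorProduct.map f g) h ∘ₗ α K M N P
      = α K M' N' P' ∘ₗ TensorProduct.map f (TensorProduct.map g h) := by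
    ext; simp
  exact LinearMap.congr_fun H t

end Tensor

section Prod

variable {K : Type*} [Field K] [CharZero K]
variable {A V M N P : Type*}
variable [AddCommGroup A] [Module K A] [AddCommGroup V] [Module K V]
variable [AddCommGroup M] [Module K M] [AddCommGroup N] [Module K N] [AddCommGroup P] [Module K P]

theorem map_prod_left (f : A × V →ₗ[K] M) (g : N →ₗ[K] P) (t : (A × V) ⊗[K] N) :
    TensorProduct.map f g t
      = rTensor P (f ∘ₗ inl K A V) (TensorProduct.map (fst K A V) g t)
        + rTensor P (f ∘ₗ inr K A V) (TensorProduct.map (snd K A V) g t) := by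
  induction t with
  | zero => simp
  | add x y hx hy => simp only [map_add, hx, hy]; abel
  | tmul e n => simp [← add_tmul, ← map_add]

theorem map_prod_right (f : N →ₗ[K] P) (g : A × V →ₗ[K] M) (t : N ⊗[K] (A × V)) :
    TensorProduct.map f g t
      = lTensor P (g ∘ₗ inl K A V) (TensorProduct.map f (fst K A V) t)
        + lTensor P (g ∘ₗ inr K A V) (TensorProduct.map f (snd K A V) t) := by
  induction t with
  | zero => simp
  | add x y hx hy => simp only [map_add, hx, hy]; abel
  | tmul n e => simp [← tmul_add, ← map_add]

/-- The component of a tensor in `(E ⊗ E) ⊗ E`, where `E = A × V`, selected by three linear maps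
out of `E`. -/
noncomputable abbrev component (f : A × V →ₗ[K] M) (g : A × V →ₗ[K] N) (h : A × V →ₗ[K] P) :
    ((A × V) ⊗[K] (A × V)) ⊗[K] (A × V) →ₗ[K] (M ⊗[K] N) ⊗[K] P :=
  TensorProduct.map (TensorProduct.map f g) h

theorem tensor_prod_triple_ext {t u : ((A × V) ⊗[K] (A × V)) ⊗[K] (A × V)}
    (hAAA : component (fst K A V) (fst K A V) (fst K A V) t
      = component (fst K A V) (fst K A V) (fst K A V) u)
    (hAAV : component (fst K A V) (fst K A V) (snd K A V) t
      = component (fst K A V) (fst K A V) (snd K A V) u)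
    (hAVA : component (fst K A V) (snd K A V) (fst K A V) t
      = component (fst K A V) (snd K A V) (fst K A V) u)
    (hAVV : component (fst K A V) (snd K A V) (snd K A V) t
      = component (fst K A V) (snd K A V) (snd K A V) u)
    (hVAA : component (snd K A V) (fst K A V) (fst K A V) t
      = component (snd K A V) (fst K A V) (fst K A V) u)
    (hVAV : component (snd K A V) (fst K A V) (snd K A V) t
      = component (snd K A V) (fst K A V) (snd K A V) u)
    (hVVA : component (snd K A V) (snd K A V) (fst K A V) t
      = component (snd K A V) (snd K A V) (fst K A V) u)
    (hVVV : component (snd K A V) (snd K A V) (snd K A V) t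
      = component (snd K A V) (snd K A V) (snd K A V) u) : t = u := by
  have h : LinearMap.id
      = TensorProduct.map (TensorProduct.map (inl K A V) (inl K A V)) (inl K A V) ∘ₗ
          component (fst K A V) (fst K A V) (fst K A V)
        + TensorProduct.map (TensorProduct.map (inl K A V) (inl K A V)) (inr K A V) ∘ₗ
          component (fst K A V) (fst K A V) (snd K A V)
        + TensorProduct.map (TensorProduct.map (inl K A V) (inr K A V)) (inl K A V) ∘ₗ
          component (fst K A V) (snd K A V) (fst K A V)
        + TensorProduct.map (TensorProduct.map (inl K A V) (inr K A V)) (inr K A V) ∘ₗ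
          component (fst K A V) (snd K A V) (snd K A V)
        + TensorProduct.map (TensorProduct.map (inr K A V) (inl K A V)) (inl K A V) ∘ₗ
          component (snd K A V) (fst K A V) (fst K A V)
        + TensorProduct.map (TensorProduct.map (inr K A V) (inl K A V)) (inr K A V) ∘ₗ
          component (snd K A V) (fst K A V) (snd K A V)
        + TensorProduct.map (TensorProduct.map (inr K A V) (inr K A V)) (inl K A V) ∘ₗ
          component (snd K A V) (snd K A V) (fst K A V)
        + TensorProduct.map (TensorProduct.map (inr K A V) (inr K A V)) (inr K A V) ∘ₗ
          component (snd K A V) (snd K A V) (snd K A V) := by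
    ext <;> simp [component]
  rw [← LinearMap.id_apply (R := K) t, ← LinearMap.id_apply (R := K) u, h]
  simp only [LinearMap.add_apply, LinearMap.comp_apply, *]

theorem eq_τ₁₃_iff_components (t : ((A × V) ⊗[K] (A × V)) ⊗[K] (A × V)) :
    t = τ₁₃ K _ _ _ t ↔
      component (fst K A V) (fst K A V) (fst K A V) t
        = τ₁₃ K A A A (component (fst K A V) (fst K A V) (fst K A V) t) ∧
      component (snd K A V) (fst K A V) (fst K A V) t
        = τ₁₃ K A A V (component (fst K A V) (fst K A V) (snd K A V) t) ∧
      component (fst K A V) (snd K A V) (fst K A V) t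
        = τ₁₃ K A V A (component (fst K A V) (snd K A V) (fst K A V) t) ∧
      component (snd K A V) (snd K A V) (fst K A V) t
        = τ₁₃ K A V V (component (fst K A V) (snd K A V) (snd K A V) t) ∧
      component (snd K A V) (fst K A V) (snd K A V) t
        = τ₁₃ K V A V (component (snd K A V) (fst K A V) (snd K A V) t) ∧
      component (snd K A V) (snd K A V) (snd K A V) t
        = τ₁₃ K V V V (component (snd K A V) (snd K A V) (snd K A V) t) := by
  refine ⟨fun h => ?_, fun ⟨hAAA, hVAA, hAVA, hVVA, hVAV, hVVV⟩ => ?_⟩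
  · simp only [component, ← map_τ₁₃, ← h, and_self]
  · apply tensor_prod_triple_ext <;> simp only [component, map_τ₁₃]
    · exact hAAA
    · exact (eq_τ₁₃_comm _ _).1 hVAA
    · exact hAVA
    · exact (eq_τ₁₃_comm _ _).1 hVVA
    · exact hVAA
    · exact hVAV
    · exact hVVA
    · exact hVVV

theorem coassocDefect_apply (Δ : M →ₗ[K] M ⊗[K] M) (m : M) :
    coassocDefect Δ m = rTensor M Δ (Δ m) - α K M M M (lTensor M Δ (Δ m)) :=
  rfl

theorem component_coassocDefect (Δ : A × V →ₗ[K] (A × V) ⊗[K] (A × V)) (f : A × V →ₗ[K] M)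
    (g : A × V →ₗ[K] N) (h : A × V →ₗ[K] P) (e : A × V) :
    component f g h (coassocDefect Δ e)
      = rTensor P (TensorProduct.map f g ∘ₗ Δ ∘ₗ inl K A V)
          (TensorProduct.map (fst K A V) h (Δ e))
        + rTensor P (TensorProduct.map f g ∘ₗ Δ ∘ₗ inr K A V)
          (TensorProduct.map (snd K A V) h (Δ e))
        - α K M N P (lTensor M (TensorProduct.map g h ∘ₗ Δ ∘ₗ inl K A V)
          (TensorProduct.map f (fst K A V) (Δ e)))
        - α K M N P (lTensor M (TensorProduct.map g h ∘ₗ Δ ∘ₗ inr K A V)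
          (TensorProduct.map f (snd K A V) (Δ e))) := by
  have hl : component f g h (rTensor (A × V) Δ (Δ e))
      = TensorProduct.map (TensorProduct.map f g ∘ₗ Δ) h (Δ e) := by
    rw [component, ← LinearMap.comp_apply, map_comp_rTensor]
  have hr : component f g h (α K _ _ _ (lTensor (A × V) Δ (Δ e)))
      = α K M N P (TensorProduct.map f (TensorProduct.map g h ∘ₗ Δ) (Δ e)) := by
    rw [component, map_α, ← LinearMap.comp_apply (TensorProduct.map f _), map_comp_lTensor]
  rw [coassocDefect_apply, map_sub, hl, hr, map_prod_left, map_prod_right f, map_add]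
  simp only [LinearMap.comp_assoc]
  abel

section Comul

variable (ΔA : A →ₗ[K] A ⊗[K] A) (ΔV : V →ₗ[K] V ⊗[K] V)
  (φ : A →ₗ[K] V ⊗[K] A) (ψ : A →ₗ[K] A ⊗[K] V) (ρ : V →ₗ[K] A ⊗[K] V)
  (γ : V →ₗ[K] V ⊗[K] A) (P : A →ₗ[K] V ⊗[K] V) (Q : V →ₗ[K] A ⊗[K] A)

theorem map_prodComul (f : A × V →ₗ[K] M) (g : A × V →ₗ[K] N) (e : A × V) :
    TensorProduct.map f g (prodComul ΔA ΔV φ ψ ρ γ P Q e)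
      = TensorProduct.map (f ∘ₗ inl K A V) (g ∘ₗ inl K A V) (ΔA e.1 + Q e.2)
        + TensorProduct.map (f ∘ₗ inr K A V) (g ∘ₗ inl K A V) (φ e.1 + γ e.2)
        + TensorProduct.map (f ∘ₗ inl K A V) (g ∘ₗ inr K A V) (ψ e.1 + ρ e.2)
        + TensorProduct.map (f ∘ₗ inr K A V) (g ∘ₗ inr K A V) (P e.1 + ΔV e.2) := by
  simp only [prodComul, LinearMap.add_apply, LinearMap.comp_apply, map_add, TensorProduct.map_comp,
    fst_apply, snd_apply]
  abel

theorem map_fst_fst_prodComul (e : A × V) :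
    TensorProduct.map (fst K A V) (fst K A V) (prodComul ΔA ΔV φ ψ ρ γ P Q e)
      = ΔA e.1 + Q e.2 := by
  simp [map_prodComul]

theorem map_snd_fst_prodComul (e : A × V) :
    TensorProduct.map (snd K A V) (fst K A V) (prodComul ΔA ΔV φ ψ ρ γ P Q e)
      = φ e.1 + γ e.2 := by
  simp [map_prodComul]

theorem map_fst_snd_prodComul (e : A × V) :
    TensorProduct.map (fst K A V) (snd K A V) (prodComul ΔA ΔV φ ψ ρ γ P Q e)
      = ψ e.1 + ρ e.2 := by
  simp [map_prodComul]

theorem map_snd_snd_prodComul (e : A × V) :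
    TensorProduct.map (snd K A V) (snd K A V) (prodComul ΔA ΔV φ ψ ρ γ P Q e)
      = P e.1 + ΔV e.2 := by
  simp [map_prodComul]

theorem map_fst_fst_comp_prodComul :
    TensorProduct.map (fst K A V) (fst K A V) ∘ₗ prodComul ΔA ΔV φ ψ ρ γ P Q = ΔA.coprod Q :=
  LinearMap.ext (map_fst_fst_prodComul ΔA ΔV φ ψ ρ γ P Q)

theorem map_snd_fst_comp_prodComul :
    TensorProduct.map (snd K A V) (fst K A V) ∘ₗ prodComul ΔA ΔV φ ψ ρ γ P Q = φ.coprod γ :=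
  LinearMap.ext (map_snd_fst_prodComul ΔA ΔV φ ψ ρ γ P Q)

theorem map_fst_snd_comp_prodComul :
    TensorProduct.map (fst K A V) (snd K A V) ∘ₗ prodComul ΔA ΔV φ ψ ρ γ P Q = ψ.coprod ρ :=
  LinearMap.ext (map_fst_snd_prodComul ΔA ΔV φ ψ ρ γ P Q)

theorem map_snd_snd_comp_prodComul :
    TensorProduct.map (snd K A V) (snd K A V) ∘ₗ prodComul ΔA ΔV φ ψ ρ γ P Q = P.coprod ΔV :=
  LinearMap.ext (map_snd_snd_prodComul ΔA ΔV φ ψ ρ γ P Q)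

end Comul

theorem isAFCoalgebra_prod_iff (Δ : A × V →ₗ[K] (A × V) ⊗[K] (A × V)) :
    IsAFCoalgebra Δ ↔
      (∀ a, coassocDefect Δ (a, 0) = τ₁₃ K _ _ _ (coassocDefect Δ (a, 0))) ∧
      (∀ x, coassocDefect Δ (0, x) = τ₁₃ K _ _ _ (coassocDefect Δ (0, x))) := by
  refine ⟨fun h => ⟨fun a => h _, fun x => h _⟩, fun ⟨h₁, h₂⟩ ⟨a, x⟩ => ?_⟩
  rw [show (a, x) = (a, 0) + ((0, x) : A × V) by simp, map_add, map_add, ← h₁, ← h₂]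

end Prod

end AntiFlexible

/-- the type (c1) unified coproduct `A^P # V` is an
anti-flexible coalgebra iff conditions (C1)-(C10) hold. -/
theorem unified_coproduct_c1_iff
    (K A V : Type*) [Field K] [CharZero K]
    [AddCommGroup A] [Module K A] [AddCommGroup V] [Module K V]
    (ΔA : A →ₗ[K] A ⊗[K] A) (ΔV : V →ₗ[K] V ⊗[K] V)
    (φ : A →ₗ[K] V ⊗[K] A) (ψ : A →ₗ[K] A ⊗[K] V)
    (ρ : V →ₗ[K] A ⊗[K] V) (γ : V →ₗ[K] V ⊗[K] A)
    (P : A →ₗ[K] V ⊗[K] V)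
    (hA : IsAFCoalgebra ΔA) :
    IsAFCoalgebra (prodComul ΔA ΔV φ ψ ρ γ P 0)
      ↔
      -- (C1)
      ((∀ a : A, rTensor A φ (ΔA a) + rTensor A γ (φ a)
          - α K V A A (lTensor V ΔA (φ a))
        = τ₁₃ K A A V (rTensor V ΔA (ψ a) - α K A A V (lTensor A ψ (ΔA a))
          - α K A A V (lTensor A ρ (ψ a)))) ∧
      -- (C2)
      (∀ a : A, rTensor A ψ (ΔA a) + rTensor A ρ (φ a)
          - α K A V A (lTensor A φ (ΔA a)) - α K A V A (lTensor A γ (ψ a))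
        = τ₁₃ K A V A (rTensor A ψ (ΔA a) + rTensor A ρ (φ a)
          - α K A V A (lTensor A φ (ΔA a)) - α K A V A (lTensor A γ (ψ a)))) ∧
      -- (C3)
      (∀ a : A, rTensor A ΔV (φ a) + rTensor A P (ΔA a)
          - α K V V A (lTensor V φ (φ a)) - α K V V A (lTensor V γ (P a))
        = τ₁₃ K A V V (rTensor V ψ (ψ a) + rTensor V ρ (P a)
          - α K A V V (lTensor A ΔV (ψ a)) - α K A V V (lTensor A P (ΔA a)))) ∧
      -- (C4)
      (∀ a : A, α K V A V (lTensor V ψ (φ a)) + α K V A V (lTensor V ρ (P a))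
          - rTensor V φ (ψ a) - rTensor V γ (P a)
        = τ₁₃ K V A V (α K V A V (lTensor V ψ (φ a)) + α K V A V (lTensor V ρ (P a))
          - rTensor V φ (ψ a) - rTensor V γ (P a))) ∧
      -- (C5)
      (∀ x : V, rTensor V ρ (ΔV x) + rTensor V ψ (ρ x)
          - α K A V V (lTensor A ΔV (ρ x))
        = τ₁₃ K V V A (rTensor A ΔV (γ x) - α K V V A (lTensor V φ (γ x))
          - α K V V A (lTensor V γ (ΔV x)))) ∧
      -- (C6)
      (∀ x : V, rTensor V γ (ΔV x) + rTensor V φ (ρ x)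
          - α K V A V (lTensor V ψ (γ x)) - α K V A V (lTensor V ρ (ΔV x))
        = τ₁₃ K V A V (rTensor V γ (ΔV x) + rTensor V φ (ρ x)
          - α K V A V (lTensor V ψ (γ x)) - α K V A V (lTensor V ρ (ΔV x)))) ∧
      -- (C7)
      (∀ x : V, rTensor V ΔA (ρ x) - α K A A V (lTensor A ρ (ρ x))
        = τ₁₃ K V A A (rTensor A γ (γ x) - α K V A A (lTensor V ΔA (γ x)))) ∧
      -- (C8)
      (∀ x : V, rTensor A ρ (γ x) - α K A V A (lTensor A γ (ρ x))
        = τ₁₃ K A V A (rTensor A ρ (γ x) - α K A V A (lTensor A γ (ρ x)))) ∧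
      -- (C9)
      (∀ a : A, rTensor V ΔV (P a) - α K V V V (lTensor V ΔV (P a))
          + rTensor V P (ψ a) - α K V V V (lTensor V P (φ a))
        = τ₁₃ K V V V (rTensor V ΔV (P a) - α K V V V (lTensor V ΔV (P a))
          + rTensor V P (ψ a) - α K V V V (lTensor V P (φ a)))) ∧
      -- (C10)
      (∀ x : V, rTensor V ΔV (ΔV x) - α K V V V (lTensor V ΔV (ΔV x))
          + rTensor V P (ρ x) - α K V V V (lTensor V P (γ x))
        = τ₁₃ K V V V (rTensor V ΔV (ΔV x) - α K V V V (lTensor V ΔV (ΔV x))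
          + rTensor V P (ρ x) - α K V V V (lTensor V P (γ x)))))
  := by
  rw [isAFCoalgebra_prod_iff]
  simp only [eq_τ₁₃_iff_components, component_coassocDefect, ← LinearMap.comp_assoc,
    map_fst_fst_comp_prodComul, map_snd_fst_comp_prodComul, map_fst_snd_comp_prodComul,
    map_snd_snd_comp_prodComul, coprod_inl, coprod_inr, map_fst_fst_prodComul,
    map_snd_fst_prodComul, map_fst_snd_prodComul, map_snd_snd_prodComul, map_zero, add_zero,
    zero_add, LinearMap.zero_apply, rTensor_zero, lTensor_zero, sub_zero, forall_and,
    true_and]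
  simp only [IsAFCoalgebra, coassocDefect_apply] at hA
  constructor
  · rintro ⟨⟨-, h1, h2, h3, h4, h9⟩, h7, h8, h5, h6, h10⟩
    refine ⟨h1, h2, fun a => ?_, fun a => ?_, fun x => (eq_τ₁₃_comm _ _).2 ?_, fun x => ?_,
      fun x => (eq_τ₁₃_comm _ _).2 (h7 x), h8, fun a => ?_, fun x => ?_⟩
    · have h := h3 a
      simp only [map_add, map_sub] at h ⊢
      linear_combination (norm := abel) h
    · have h := h4 a
      simp only [map_add, map_sub] at h ⊢
      linear_combination (norm := abel) -h
    · have h := h5 x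
      simp only [map_add, map_sub] at h ⊢
      linear_combination (norm := abel) h
    · have h := h6 x
      simp only [map_add, map_sub] at h ⊢
      linear_combination (norm := abel) h
    · have h := h9 a
      simp only [map_add, map_sub] at h ⊢
      linear_combination (norm := abel) h
    · have h := h10 x
      simp only [map_add, map_sub] at h ⊢
      linear_combination (norm := abel) h
  · rintro ⟨h1, h2, h3, h4, h5, h6, h7, h8, h9, h10⟩
    refine ⟨⟨hA, h1, h2, fun a => ?_, fun a => ?_, fun a => ?_⟩,
      fun x => (eq_τ₁₃_comm _ _).1 (h7 x), h8, fun x => ?_, fun x => ?_, fun x => ?_⟩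
    · have h := h3 a
      simp only [map_add, map_sub] at h ⊢
      linear_combination (norm := abel) h
    · have h := h4 a
      simp only [map_add, map_sub] at h ⊢
      linear_combination (norm := abel) -h
    · have h := h9 a
      simp only [map_add, map_sub] at h ⊢
      linear_combination (norm := abel) h
    · have h := (eq_τ₁₃_comm _ _).1 (h5 x)
      simp only [map_add, map_sub] at h ⊢
      linear_combination (norm := abel) h
    · have h := h6 x
      simp only [map_add, map_sub] at h ⊢
      linear_combination (norm := abel) h
    · have h := h10 x
      simp only [map_add, map_sub] at h ⊢
      linear_combination (norm := abel) h
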